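/- arXiv:2004.07831 — 7 statements merged into one kernel-verified Lean document; each statement's English description precedes it below -/
import Mathlib

section
/- Let N be a positive integer, let A be a symmetric N×N real matrix, and let S be a finite set of indices of cardinality m such that all rows of A indexed by S coincide, i.e. for all i, j ∈ S and all k, A i k = A j k. Let w be the common row sum, w = ∑_k A i k for any i ∈ S, and let L = diagonal(fun i => ∑_k A i k) - A be the Laplacian matrix of A. Then w is an eigenvalue of L with multiplicity at least m - 1; precisely, for all i, j ∈ S one has L.mulVec (e_i - e_j) = w • (e_i - e_j), and the eigenspace of L for the eigenvalue w has dimension at least m - 1. -/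
open Matrix

/-- If a symmetric real matrix `A` has `m` coinciding rows (indexed by a set `S` of
cardinality `m`) with common row sum `w`, then `w` is an eigenvalue of the Laplacian
`L = diag(row sums) - A` of multiplicity at least `m - 1`: each difference
`e_i - e_j` (`i, j ∈ S`) satisfies `L (e_i - e_j) = w (e_i - e_j)`, and the
eigenspace of `L` for `w` has dimension at least `m - 1`. -/
theorem laplacian_eigenvalue_of_equal_rows
    (N : ℕ) (hN : 0 < N) (A : Matrix (Fin N) (Fin N) ℝ) (hA : A.IsSymm)
    (S : Finset (Fin N)) (m : ℕ) (hS : S.card = m)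
    (hrows : ∀ i ∈ S, ∀ j ∈ S, ∀ k, A i k = A j k)
    (w : ℝ) (hw : ∀ i ∈ S, ∑ k, A i k = w) :
    let L : Matrix (Fin N) (Fin N) ℝ := Matrix.diagonal (fun i => ∑ k, A i k) - A
    (∀ i ∈ S, ∀ j ∈ S,
      L.mulVec (Pi.single i 1 - Pi.single j 1) = w • (Pi.single i 1 - Pi.single j 1)) ∧
    m - 1 ≤ Module.finrank ℝ (Module.End.eigenspace (Matrix.mulVecLin L) w) := by
  intro L
  have heig : ∀ i ∈ S, ∀ j ∈ S,
      L.mulVec (Pi.single i 1 - Pi.single j 1) = w • (Pi.single i 1 - Pi.single j 1) := by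
    intro i hi j hj
    have hdiag : ∀ i ∈ S, (Matrix.diagonal (fun i => ∑ k, A i k)) *ᵥ Pi.single i 1 =
        w • (Pi.single i 1 : Fin N → ℝ) := by
      intro i hi
      rw [Matrix.diagonal_mulVec_single, hw i hi, ← Pi.single_smul, smul_eq_mul]
    have hcol : A *ᵥ Pi.single i 1 = A *ᵥ Pi.single j 1 := by
      ext k
      simpa using (hA.apply i k).trans ((hrows i hi j hj k).trans (hA.apply j k).symm)
    rw [Matrix.sub_mulVec, Matrix.mulVec_sub, Matrix.mulVec_sub, hdiag i hi, hdiag j hj, hcol,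
      sub_self, sub_zero, smul_sub]
  refine ⟨heig, ?_⟩
  rcases Nat.eq_zero_or_pos m with rfl | hm
  · simp
  have haff : AffineIndependent ℝ (Pi.basisFun ℝ (Fin N)) :=
    (Pi.basisFun ℝ (Fin N)).linearIndependent.affineIndependent
  rw [← haff.finrank_vectorSpan_image_finset (s := S) (n := m - 1) (by omega)]
  refine Submodule.finrank_mono (Submodule.span_le.2 ?_)
  rintro _ ⟨_, hp, _, hq, rfl⟩
  obtain ⟨i, hi, rfl⟩ := Finset.mem_image.1 (Finset.mem_coe.1 hp)
  obtain ⟨j, hj, rfl⟩ := Finset.mem_image.1 (Finset.mem_coe.1 hq)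
  simpa [Module.End.mem_eigenspace_iff] using heig i hi j hj
end

section
/- Let N be a positive integer, let A be a symmetric N×N real matrix, and let S₁, ..., S_r be pairwise disjoint finite sets of indices with |S_l| = m_l, such that within each S_l all rows of A coincide (for all i, j ∈ S_l and all k, A i k = A j k), and such that there is a single real number w with ∑_k A i k = w for every i ∈ ⋃_l S_l. Let L = diagonal(fun i => ∑_k A i k) - A be the Laplacian matrix of A. Then w is an eigenvalue of L with multiplicity at least ∑_{l=1}^{r} (m_l - 1); precisely, the eigenspace of L for the eigenvalue w has dimension at least ∑_{l=1}^{r} (m_l - 1). -/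
open Matrix

/-- If the rows `i` and `j` of a symmetric matrix coincide, with sum `w`, then `eᵢ - eⱼ` is
annihilated by `L - w`, where `L` is the Laplacian. -/
lemma single_sub_single_mem_eigenspace_laplacian {n R : Type*} [Fintype n] [DecidableEq n]
    [CommRing R] {A : Matrix n n R} (hA : A.IsSymm) {i j : n} (hij : ∀ k, A i k = A j k)
    {w : R} (hj : ∑ k, A j k = w) :
    (Pi.single i 1 - Pi.single j 1 : n → R) ∈ Module.End.eigenspace
      (Matrix.mulVecLin (Matrix.diagonal (fun i => ∑ k, A i k) - A)) w := by
  rw [Module.End.mem_eigenspace_iff]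
  ext k
  have hk : A k i = A k j := by rw [hA.apply i k, hA.apply j k, hij]
  simp only [Matrix.mulVecLin_apply, Matrix.mulVec_sub, Matrix.mulVec_single_one,
    Pi.sub_apply, Matrix.col_apply, Matrix.sub_apply, Matrix.diagonal_apply, Pi.smul_apply,
    smul_eq_mul, hk, sub_sub_sub_cancel_right, Pi.single_apply]
  split_ifs <;> simp_all

/-- Given pairwise disjoint finite sets `S l` and base points `c l`, lying in `S l` whenever it is
nonempty, the vectors `eᵢ - e_{c l}` with `i ∈ S l`, `i ≠ c l`, are linearly independent. -/
lemma linearIndependent_single_sub_single {ι n R : Type*} [Finite ι] [DecidableEq n]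
    [CommRing R] {S : ι → Finset n} (hS : ∀ l l', l ≠ l' → Disjoint (S l) (S l'))
    {c : ι → n} (hc : ∀ l, (S l).Nonempty → c l ∈ S l) :
    LinearIndependent R (fun p : Σ l, ↥((S l).erase (c l)) =>
      (Pi.single (p.2 : n) 1 - Pi.single (c p.1) 1 : n → R)) := by
  classical
  have hS' : ∀ {l l' : ι} {i : n}, i ∈ S l → i ∈ S l' → l = l' := fun {l l' i} h h' => by
    by_contra hne
    exact Finset.disjoint_left.mp (hS l l' hne) h h'
  apply LinearIndependent.of_comp
    (LinearMap.funLeft R R (fun p : Σ l, ↥((S l).erase (c l)) => (p.2 : n)))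
  convert (Pi.basisFun R (Σ l, ↥((S l).erase (c l)))).linearIndependent using 1
  ext ⟨l, i, hi⟩ ⟨l', j, hj⟩
  have hi' := Finset.mem_of_mem_erase hi
  have hj' := Finset.mem_of_mem_erase hj
  have hjc : j ≠ c l := by
    rintro rfl
    obtain rfl := hS' hj' (hc l ⟨i, hi'⟩)
    exact Finset.ne_of_mem_erase hj rfl
  by_cases hij : j = i
  · subst hij
    obtain rfl := hS' hi' hj'
    simp [LinearMap.funLeft_apply, hjc]
  · have hne : (⟨l', j, hj⟩ : Σ l, ↥((S l).erase (c l))) ≠ ⟨l, i, hi⟩ := by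
      intro h
      exact hij (congrArg (fun p : Σ l, ↥((S l).erase (c l)) => (p.2 : n)) h)
    simp [LinearMap.funLeft_apply, hjc, hij, Pi.single_eq_of_ne hne]

/-- If a symmetric real matrix `A` has `r` pairwise disjoint families of coinciding rows
(the `l`-th family indexed by a set `S l` of cardinality `m l`), all with the same row
sum `w`, then `w` is an eigenvalue of the Laplacian `L = diag(row sums) - A` of
multiplicity at least `∑ l, (m l - 1)`. -/
theorem laplacian_eigenvalue_of_hyperstars
    (N r : ℕ) (hN : 0 < N) (A : Matrix (Fin N) (Fin N) ℝ) (hA : A.IsSymm)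
    (S : Fin r → Finset (Fin N)) (m : Fin r → ℕ)
    (hcard : ∀ l, (S l).card = m l)
    (hdisj : ∀ l l', l ≠ l' → Disjoint (S l) (S l'))
    (hrows : ∀ l, ∀ i ∈ S l, ∀ j ∈ S l, ∀ k, A i k = A j k)
    (w : ℝ) (hw : ∀ l, ∀ i ∈ S l, ∑ k, A i k = w) :
    let L : Matrix (Fin N) (Fin N) ℝ := Matrix.diagonal (fun i => ∑ k, A i k) - A
    (∑ l, (m l - 1)) ≤ Module.finrank ℝ (Module.End.eigenspace (Matrix.mulVecLin L) w) := by
  intro L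
  have hex : ∀ l, ∃ c, (S l).Nonempty → c ∈ S l := fun l => by
    rcases (S l).eq_empty_or_nonempty with h | ⟨c, hc⟩
    · exact ⟨⟨0, hN⟩, by simp [h]⟩
    · exact ⟨c, fun _ => hc⟩
  choose c hc using hex
  have hmem : ∀ p : Σ l, ↥((S l).erase (c l)),
      (Pi.single (p.2 : Fin N) 1 - Pi.single (c p.1) 1 : Fin N → ℝ) ∈
        Module.End.eigenspace (Matrix.mulVecLin L) w := by
    rintro ⟨l, i, hi⟩
    have hi' := Finset.mem_of_mem_erase hi
    have hcl := hc l ⟨i, hi'⟩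
    exact single_sub_single_mem_eigenspace_laplacian hA (hrows l i hi' _ hcl)
      (hw l _ hcl)
  have hli : LinearIndependent ℝ (fun p => (⟨_, hmem p⟩ :
      Module.End.eigenspace (Matrix.mulVecLin L) w)) :=
    LinearIndependent.of_comp (Submodule.subtype _)
      (linearIndependent_single_sub_single (R := ℝ) hdisj hc)
  calc ∑ l, (m l - 1) ≤ ∑ l, ((S l).erase (c l)).card :=
        Finset.sum_le_sum fun l _ => hcard l ▸ Finset.pred_card_le_card_erase
    _ = Fintype.card (Σ l, ↥((S l).erase (c l))) := by
        simp only [Fintype.card_sigma, Fintype.card_coe]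
    _ ≤ _ := hli.fintype_card_le_finrank
end

section
/- Let N be a positive integer, let A be a symmetric N×N real matrix with all row sums positive (∑_k A i k > 0 for every i), and let S₁, ..., S_r be pairwise disjoint finite sets of indices with |S_l| = m_l, such that within each S_l all rows of A coincide (for all i, j ∈ S_l and all k, A i k = A j k), and such that there is a single real number w with ∑_k A i k = w for every i ∈ ⋃_l S_l. Let D = diagonal(fun i => ∑_k A i k) and let T = D⁻¹ * A be the transition matrix. Then 0 is an eigenvalue of T with multiplicity at least ∑_{l=1}^{r} (m_l - 1); precisely, the kernel of the linear map x ↦ T.mulVec x has dimension at least ∑_{l=1}^{r} (m_l - 1). -/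
open Matrix

/-- If every row of `A` coincides with a row indexed by `s`, then `A` has rank at most `#s`. -/
theorem Matrix.rank_le_card_of_forall_exists_row_eq {m n K : Type*} [Finite m] [Fintype n]
    [Field K] (A : Matrix m n K) (s : Finset m) (h : ∀ i, ∃ j ∈ s, A j = A i) :
    A.rank ≤ s.card := by
  classical
  have hrange : Set.range A.row = (s.image A.row : Finset (n → K)) := by
    ext v
    simp only [Set.mem_range, Finset.mem_coe, Finset.mem_image]
    constructor
    · rintro ⟨i, rfl⟩
      exact h i
    · rintro ⟨j, -, rfl⟩
      exact ⟨j, rfl⟩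
  rw [A.rank_eq_finrank_span_row, hrange]
  exact (finrank_span_finset_le_card _).trans Finset.card_image_le

/-- If each of the pairwise disjoint sets `S l` indexes a family of coinciding rows of `A`, then
the rank of `A` drops by at least `∑ l, (#(S l) - 1)` below the number of rows. -/
theorem Matrix.rank_add_sum_card_sub_one_le {ι m n K : Type*} [Fintype ι] [Fintype m] [Fintype n]
    [Field K] (A : Matrix m n K) (S : ι → Finset m)
    (hdisj : ∀ l l', l ≠ l' → Disjoint (S l) (S l'))
    (hrows : ∀ l, ∀ i ∈ S l, ∀ j ∈ S l, A i = A j) :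
    A.rank + ∑ l, ((S l).card - 1) ≤ Fintype.card m := by
  classical
  have hbase : ∀ l, ∃ B ⊆ S l, B.card = (S l).card - 1 ∧
      ((S l).Nonempty → ∃ b ∈ S l, b ∉ B) := by
    intro l
    rcases (S l).eq_empty_or_nonempty with h | ⟨b, hb⟩
    · exact ⟨∅, by simp, by simp [h], by simp [h]⟩
    · exact ⟨(S l).erase b, Finset.erase_subset _ _, Finset.card_erase_of_mem hb,
        fun _ => ⟨b, hb, Finset.notMem_erase _ _⟩⟩
  choose B hBS hBcard hB using hbase
  have hcard : (Finset.univ.biUnion B).card = ∑ l, ((S l).card - 1) := by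
    rw [Finset.card_biUnion fun l _ l' _ hl => (hdisj l l' hl).mono (hBS l) (hBS l')]
    exact Finset.sum_congr rfl fun l _ => hBcard l
  have hrank : A.rank ≤ (Finset.univ.biUnion B)ᶜ.card := by
    refine A.rank_le_card_of_forall_exists_row_eq _ fun i => ?_
    by_cases hi : i ∈ Finset.univ.biUnion B
    · obtain ⟨l, -, hil⟩ := Finset.mem_biUnion.mp hi
      obtain ⟨b, hbS, hbB⟩ := hB l ⟨i, hBS l hil⟩
      refine ⟨b, ?_, hrows l b hbS i (hBS l hil)⟩
      simp only [Finset.mem_compl, Finset.mem_biUnion, Finset.mem_univ, true_and, not_exists]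
      intro l' hbl'
      rcases eq_or_ne l l' with rfl | hl
      · exact hbB hbl'
      · exact Finset.disjoint_left.mp (hdisj l l' hl) hbS (hBS l' hbl')
    · exact ⟨i, Finset.mem_compl.mpr hi, rfl⟩
  rw [← Finset.card_add_card_compl (Finset.univ.biUnion B), hcard]
  omega

/-- If a symmetric real matrix `A` with positive row sums has `r` pairwise disjoint
families of coinciding rows (the `l`-th family indexed by a set `S l` of cardinality
`m l`), all with the same row sum `w`, then `0` is an eigenvalue of the transition
matrix `T = D⁻¹ * A` of multiplicity at least `∑ l, (m l - 1)`: the kernel of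
`x ↦ T.mulVec x` has dimension at least `∑ l, (m l - 1)`. -/
theorem transition_matrix_kernel_of_hyperstars
    (N r : ℕ) (hN : 0 < N) (A : Matrix (Fin N) (Fin N) ℝ) (hA : A.IsSymm)
    (hpos : ∀ i, 0 < ∑ k, A i k)
    (S : Fin r → Finset (Fin N)) (m : Fin r → ℕ)
    (hcard : ∀ l, (S l).card = m l)
    (hdisj : ∀ l l', l ≠ l' → Disjoint (S l) (S l'))
    (hrows : ∀ l, ∀ i ∈ S l, ∀ j ∈ S l, ∀ k, A i k = A j k)
    (w : ℝ) (hw : ∀ l, ∀ i ∈ S l, ∑ k, A i k = w) :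
    let D : Matrix (Fin N) (Fin N) ℝ := Matrix.diagonal (fun i => ∑ k, A i k)
    let T := D⁻¹ * A
    (∑ l, (m l - 1)) ≤ Module.finrank ℝ (LinearMap.ker (Matrix.mulVecLin T)) := by
  intro D T
  have hrank := A.rank_add_sum_card_sub_one_le S hdisj
    fun l i hi j hj => funext (hrows l i hi j hj)
  simp only [hcard, Fintype.card_fin] at hrank
  have hT : T.rank ≤ A.rank := Matrix.rank_mul_le_right _ _
  have hker := T.mulVecLin.finrank_range_add_finrank_ker
  rw [Module.finrank_fin_fun] at hker
  change T.rank + _ = N at hker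
  omega
end

section
/- Let N ≥ M be positive integers, let A be a symmetric N×N real matrix with eigenvalues listed in decreasing order μ₁(A) ≥ ... ≥ μ_N(A), let K be an N×M real matrix with orthonormal columns (Kᵀ * K = 1), and let B = Kᵀ * A * K with eigenvalues listed in decreasing order μ₁(B) ≥ ... ≥ μ_M(B). Then the eigenvalues of B interlace those of A: μ_v(A) ≥ μ_v(B) ≥ μ_{N-M+v}(A) for every v = 1, ..., M. -/
open Matrix Polynomial

lemma exists_perm_comp_eq_of_map_univ_eq {ι α : Type*} [Fintype ι] {f g : ι → α}
    (h : Finset.univ.val.map f = Finset.univ.val.map g) : ∃ σ : Equiv.Perm ι, g ∘ σ = f := by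
  classical
  have e (c : α) : Nonempty ({i // f i = c} ≃ {i // g i = c}) := by
    rw [← Fintype.card_eq, Fintype.card_subtype, Fintype.card_subtype]
    have hc := congrArg (Multiset.count c) h
    rw [Multiset.count_map, Multiset.count_map] at hc
    simpa only [Finset.card_def, Finset.filter_val, eq_comm] using hc
  exact ⟨Equiv.ofFiberEquiv fun c => (e c).some, funext fun i => Equiv.ofFiberEquiv_map _ i⟩

lemma Matrix.IsSymm.exists_orthogonal_diagonalization {n : Type*} [Fintype n] [DecidableEq n]
    {A : Matrix n n ℝ} (hA : A.IsSymm) {μ : n → ℝ} (hμ : A.charpoly = ∏ i, (X - C (μ i))) :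
    ∃ U : Matrix n n ℝ, U * Uᵀ = 1 ∧ A = U * diagonal μ * Uᵀ := by
  have hH : A.IsHermitian := by
    rw [Matrix.IsHermitian, conjTranspose_eq_transpose_of_trivial]
    exact hA
  have hroots : Finset.univ.val.map μ = Finset.univ.val.map hH.eigenvalues := by
    have h := hH.roots_charpoly_eq_eigenvalues
    rw [hμ, Polynomial.roots_prod _ _ (Finset.prod_ne_zero_iff.2 fun i _ => X_sub_C_ne_zero _)] at h
    simpa using h
  obtain ⟨σ, hσ⟩ := exists_perm_comp_eq_of_map_univ_eq hroots
  let W : Matrix n n ℝ := hH.eigenvectorUnitary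
  have hWW : W * Wᵀ = 1 := by
    have := Unitary.coe_mul_star_self hH.eigenvectorUnitary
    simpa [star_eq_conjTranspose, conjTranspose_eq_transpose_of_trivial] using this
  have hspec : A = W * diagonal hH.eigenvalues * Wᵀ := by
    have := hH.spectral_theorem
    simpa [Unitary.conjStarAlgAut_apply, star_eq_conjTranspose,
      conjTranspose_eq_transpose_of_trivial, Function.comp_def] using this
  refine ⟨W.submatrix id σ, ?_, ?_⟩
  · rw [transpose_submatrix, submatrix_mul_equiv, hWW, submatrix_id_id]
  · have hd : diagonal μ = (diagonal hH.eigenvalues).submatrix σ σ := by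
      rw [submatrix_diagonal_equiv, hσ]
    rw [hd, transpose_submatrix, submatrix_mul_equiv, submatrix_mul_equiv, submatrix_id_id]
    exact hspec

lemma dotProduct_conj_diagonal_mulVec {n : Type*} [Fintype n] [DecidableEq n]
    (U : Matrix n n ℝ) (μ : n → ℝ) (x : n → ℝ) :
    x ⬝ᵥ (U * diagonal μ * Uᵀ) *ᵥ x = ∑ i, μ i * (Uᵀ *ᵥ x) i ^ 2 := by
  rw [← mulVec_mulVec, ← mulVec_mulVec, dotProduct_mulVec, ← mulVec_transpose, dotProduct]
  refine Finset.sum_congr rfl fun i _ => ?_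
  rw [mulVec_diagonal]
  ring

lemma sum_sq_transpose_mulVec {n : Type*} [Fintype n] [DecidableEq n]
    {U : Matrix n n ℝ} (hU : U * Uᵀ = 1) (x : n → ℝ) :
    ∑ i, (Uᵀ *ᵥ x) i ^ 2 = x ⬝ᵥ x := by
  have h := dotProduct_conj_diagonal_mulVec U 1 x
  simpa [hU] using h.symm

/-- If fewer than `card m` diagonal entries violate the bounds `μ ≤ a` and `b ≤ ν` in total,
then some nonzero vector avoids all of them, and comparing quadratic forms gives `b ≤ a`. -/
lemma le_of_card_add_card_lt {n m : Type*} [Fintype n] [DecidableEq n] [Fintype m] [DecidableEq m]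
    {K : Matrix n m ℝ} (hK : Kᵀ * K = 1)
    {U : Matrix n n ℝ} (hU : U * Uᵀ = 1) {V : Matrix m m ℝ} (hV : V * Vᵀ = 1)
    {μ : n → ℝ} {ν : m → ℝ}
    (hUV : Kᵀ * (U * diagonal μ * Uᵀ) * K = V * diagonal ν * Vᵀ)
    (s : Finset n) (t : Finset m) (hst : s.card + t.card < Fintype.card m) {a b : ℝ}
    (ha : ∀ i ∉ s, μ i ≤ a) (hb : ∀ j ∉ t, b ≤ ν j) : b ≤ a := by
  let f : (m → ℝ) →ₗ[ℝ] (s → ℝ) × (t → ℝ) :=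
    ((LinearMap.funLeft ℝ ℝ Subtype.val).comp (Uᵀ * K).mulVecLin).prod
      ((LinearMap.funLeft ℝ ℝ Subtype.val).comp Vᵀ.mulVecLin)
  have hker : LinearMap.ker f ≠ ⊥ := LinearMap.ker_ne_bot_of_finrank_lt (by simpa using hst)
  obtain ⟨w, hw, hw0⟩ := Submodule.exists_mem_ne_zero_of_ne_bot hker
  have hw' : f w = 0 := hw
  have hs : ∀ i ∈ s, (Uᵀ *ᵥ (K *ᵥ w)) i = 0 := fun i hi => by
    rw [mulVec_mulVec]
    exact congrFun (congrArg Prod.fst hw') ⟨i, hi⟩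
  have ht : ∀ j ∈ t, (Vᵀ *ᵥ w) j = 0 := fun j hj =>
    congrFun (congrArg Prod.snd hw') ⟨j, hj⟩
  have hpos : 0 < w ⬝ᵥ w := by
    simpa using dotProduct_star_self_pos_iff.2 hw0
  have hadj (y : n → ℝ) : w ⬝ᵥ (Kᵀ *ᵥ y) = (K *ᵥ w) ⬝ᵥ y := by
    rw [dotProduct_mulVec, vecMul_transpose]
  have hnorm : (K *ᵥ w) ⬝ᵥ (K *ᵥ w) = w ⬝ᵥ w := by
    rw [← hadj, mulVec_mulVec, hK, one_mulVec]
  have hform : ∑ j, ν j * (Vᵀ *ᵥ w) j ^ 2 = ∑ i, μ i * (Uᵀ *ᵥ (K *ᵥ w)) i ^ 2 := by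
    rw [← dotProduct_conj_diagonal_mulVec, ← dotProduct_conj_diagonal_mulVec, ← hUV, ← hadj,
      mulVec_mulVec, mulVec_mulVec, Matrix.mul_assoc]
  have hlower : b * (w ⬝ᵥ w) ≤ ∑ j, ν j * (Vᵀ *ᵥ w) j ^ 2 := by
    rw [← sum_sq_transpose_mulVec hV, Finset.mul_sum]
    refine Finset.sum_le_sum fun j _ => ?_
    by_cases hj : j ∈ t
    · simp [ht j hj]
    · exact mul_le_mul_of_nonneg_right (hb j hj) (sq_nonneg _)
  have hupper : ∑ i, μ i * (Uᵀ *ᵥ (K *ᵥ w)) i ^ 2 ≤ a * (w ⬝ᵥ w) := by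
    rw [← hnorm, ← sum_sq_transpose_mulVec hU, Finset.mul_sum]
    refine Finset.sum_le_sum fun i _ => ?_
    by_cases hi : i ∈ s
    · simp [hs i hi]
    · exact mul_le_mul_of_nonneg_right (ha i hi) (sq_nonneg _)
  exact le_of_mul_le_mul_right (hlower.trans (hform.trans_le hupper)) hpos

/-- Cauchy interlacing: if `A` is a symmetric `N×N` real matrix with eigenvalues
`μA 0 ≥ μA 1 ≥ ... ≥ μA (N-1)` (listed in decreasing order, with multiplicity, as the
roots of the characteristic polynomial), `K` has orthonormal columns (`Kᵀ * K = 1`),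
and `B = Kᵀ * A * K` has eigenvalues `μB 0 ≥ ... ≥ μB (M-1)` in decreasing order, then
`μA v ≥ μB v ≥ μA (N - M + v)` for every `v`. -/
theorem interlacing_theorem
    (N M : ℕ) (hM : 0 < M) (hMN : M ≤ N)
    (A : Matrix (Fin N) (Fin N) ℝ) (hA : A.IsSymm)
    (K : Matrix (Fin N) (Fin M) ℝ) (hK : Kᵀ * K = 1)
    (μA : Fin N → ℝ) (hμA : ∀ i j : Fin N, i ≤ j → μA j ≤ μA i)
    (hAchar : A.charpoly = ∏ i, (X - C (μA i)))
    (μB : Fin M → ℝ) (hμB : ∀ i j : Fin M, i ≤ j → μB j ≤ μB i)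
    (hBchar : (Kᵀ * A * K).charpoly = ∏ i, (X - C (μB i))) :
    ∀ v : Fin M,
      μB v ≤ μA (Fin.castLE hMN v) ∧
      μA ⟨v.val + (N - M), by have := v.isLt; omega⟩ ≤ μB v := by
  obtain ⟨U, hU, hAU⟩ := hA.exists_orthogonal_diagonalization hAchar
  have hB : (Kᵀ * A * K).IsSymm := by
    rw [Matrix.IsSymm, transpose_mul, transpose_mul, transpose_transpose, hA.eq, Matrix.mul_assoc]
  obtain ⟨V, hV, hBV⟩ := hB.exists_orthogonal_diagonalization hBchar
  rw [hAU] at hBV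
  intro v
  have hv := v.isLt
  constructor
  · refine le_of_card_add_card_lt hK hU hV hBV (Finset.Iio (Fin.castLE hMN v)) (Finset.Ioi v)
      ?_ (fun i hi => hμA _ _ (by simpa using hi)) (fun j hj => hμB _ _ (by simpa using hj))
    simp only [Fin.card_Iio, Fin.card_Ioi, Fintype.card_fin, Fin.val_castLE]
    omega
  · have hneg : Kᵀ * (U * diagonal (-μA) * Uᵀ) * K = V * diagonal (-μB) * Vᵀ := by
      have hd {k : ℕ} (d : Fin k → ℝ) : diagonal (-d) = -diagonal d := (diagonal_neg d).symm
      rw [hd, hd, Matrix.mul_neg, Matrix.neg_mul, Matrix.mul_neg, Matrix.neg_mul, Matrix.mul_neg,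
        Matrix.neg_mul, hBV]
    refine neg_le_neg_iff.1 (le_of_card_add_card_lt hK hU hV hneg
      (Finset.Ioi ⟨v.val + (N - M), by omega⟩) (Finset.Iio v) ?_
      (fun i hi => neg_le_neg (hμA _ _ (by simpa using hi)))
      (fun j hj => neg_le_neg (hμB _ _ (by simpa using hj))))
    simp only [Fin.card_Iio, Fin.card_Ioi, Fintype.card_fin]
    omega
end

section
/- Let N ≥ M be positive integers, let A be a symmetric N×N real matrix with eigenvalues listed in decreasing order μ₁(A) ≥ ... ≥ μ_N(A), let K be an N×M real matrix with orthonormal columns (Kᵀ * K = 1), and let B = Kᵀ * A * K with eigenvalues listed in decreasing order μ₁(B) ≥ ... ≥ μ_M(B). Suppose the interlacing is tight, i.e. there exists u with 0 ≤ u ≤ M such that μ_v(A) = μ_v(B) for v = 1, ..., u and μ_v(B) = μ_{N-M+v}(A) for v = u+1, ..., M. Then K * B = A * K. -/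
open Matrix Polynomial

/-- If `q` is doubly substochastic with column sums `1`, `b j = ∑ i, a i * q i j`, and `b` agrees
with the decreasing sequence `a` up to index `j`, then column `j` of `q` is supported on the
indices where `a` takes the value `b j`. -/
lemma substochastic_mul_sub_eq_zero {N M : ℕ} (hMN : M ≤ N) {a : Fin N → ℝ} (ha : Antitone a)
    {b : Fin M → ℝ} {q : Fin N → Fin M → ℝ} (hq : ∀ i j, 0 ≤ q i j)
    (hrow : ∀ i, ∑ j, q i j ≤ 1) (hcol : ∀ j, ∑ i, q i j = 1)
    (hb : ∀ j, ∑ i, a i * q i j = b j) (j : Fin M)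
    (hab : ∀ k ≤ j, a (Fin.castLE hMN k) = b k) (i : Fin N) :
    q i j * (a i - b j) = 0 := by
  have hcol' (k : Fin M) : ∑ i, (a i - b j) * q i k = b k - b j := by
    simp only [sub_mul, Finset.sum_sub_distrib, ← Finset.mul_sum, hcol, hb, mul_one]
  set r : Fin N → ℝ := fun i ↦ ∑ k ∈ Finset.Iic j, q i k with hr
  have hr0 (i) : 0 ≤ r i := Finset.sum_nonneg fun k _ ↦ hq i k
  have hr1 (i) : r i ≤ 1 :=
    (Finset.sum_le_univ_sum_of_nonneg fun k ↦ hq i k).trans (hrow i)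
  have hprefix : ∑ i ∈ Finset.Iic (Fin.castLE hMN j), (a i - b j)
      = ∑ k ∈ Finset.Iic j, (b k - b j) := by
    symm
    refine Finset.sum_bij (fun k _ ↦ Fin.castLE hMN k) ?_ ?_ ?_ ?_
    · intro k hk
      simpa using hk
    · intro k _ l _ h
      simpa using h
    · intro i hi
      have hi' : i.val ≤ j.val := by simpa [Fin.le_def] using hi
      exact ⟨⟨i, by omega⟩, by simpa [Fin.le_def] using hi', rfl⟩
    · intro k hk
      rw [hab k (by simpa using hk)]
  have hsum : ∑ i, (a i - b j) * r i = ∑ k ∈ Finset.Iic j, (b k - b j) := by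
    simp only [hr, Finset.mul_sum]
    rw [Finset.sum_comm]
    exact Finset.sum_congr rfl fun k _ ↦ hcol' k
  have hzero : ∑ i, (a i - b j) * ((if i ≤ Fin.castLE hMN j then 1 else 0) - r i) = 0 := by
    simp_rw [mul_sub, mul_ite, mul_one, mul_zero]
    rw [Finset.sum_sub_distrib, hsum, ← hprefix, ← Finset.sum_filter, sub_eq_zero]
    exact Finset.sum_congr (by ext; simp) fun i _ ↦ rfl
  have hterm (i) : (a i - b j) * ((if i ≤ Fin.castLE hMN j then 1 else 0) - r i) = 0 := by
    refine (Finset.sum_eq_zero_iff_of_nonneg fun i _ ↦ ?_).1 hzero i (Finset.mem_univ i)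
    rw [← hab j le_rfl]
    split_ifs with h
    · exact mul_nonneg (sub_nonneg.2 (ha h)) (sub_nonneg.2 (hr1 i))
    · exact mul_nonneg_of_nonpos_of_nonpos (sub_nonpos.2 (ha (le_of_not_ge h)))
        (by linarith [hr0 i])
  have hlow (i) (hi : a i < b j) : q i j = 0 := by
    have hij : ¬ i ≤ Fin.castLE hMN j := fun h ↦ by
      have := ha h
      rw [hab j le_rfl] at this
      linarith
    have h := hterm i
    rw [if_neg hij, mul_eq_zero, sub_eq_zero] at h
    have hri : r i = 0 := by
      rcases h with h | h
      · exact absurd h hi.ne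
      · linarith
    exact (Finset.sum_eq_zero_iff_of_nonneg fun k _ ↦ hq i k).1 hri j (by simp)
  rw [mul_comm]
  refine (Finset.sum_eq_zero_iff_of_nonneg fun i _ ↦ ?_).1
    ((hcol' j).trans (sub_self _)) i (Finset.mem_univ i)
  rcases lt_or_ge (a i) (b j) with h | h
  · simp [hlow i h]
  · exact mul_nonneg (sub_nonneg.2 h) (hq i j)

/-- Two families with the same multiset of values differ by a permutation of the indices. -/
lemma exists_perm_of_map_univ_eq {n α : Type*} [Fintype n] {f g : n → α}
    (h : Finset.univ.val.map f = Finset.univ.val.map g) :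
    ∃ σ : Equiv.Perm n, f = g ∘ σ := by
  classical
  have hcard (c : α) : Fintype.card {i // f i = c} = Fintype.card {i // g i = c} := by
    have hc := congrArg (Multiset.count c) h
    simp only [Multiset.count_map] at hc
    simpa [Fintype.card_subtype, Finset.card_def, Finset.filter_val, eq_comm] using hc
  exact ⟨Equiv.ofFiberEquiv fun c ↦ Fintype.equivOfCardEq (hcard c),
    funext fun i ↦ (Equiv.ofFiberEquiv_map _ i).symm⟩

/-- A real symmetric matrix is orthogonally diagonalizable with its eigenvalues in any prescribed
order. -/
lemma exists_orthogonal_mul_eq_mul_diagonal {n : Type*} [Fintype n] [DecidableEq n]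
    {A : Matrix n n ℝ} (hA : A.IsSymm) {μ : n → ℝ} (hμ : A.charpoly = ∏ i, (X - C (μ i))) :
    ∃ V : Matrix n n ℝ, Vᵀ * V = 1 ∧ V * Vᵀ = 1 ∧ A * V = V * diagonal μ := by
  have hH : A.IsHermitian := by
    rw [Matrix.IsHermitian, conjTranspose_eq_transpose_of_trivial]; exact hA
  have hroots := hH.roots_charpoly_eq_eigenvalues
  rw [hμ, Polynomial.roots_prod _ _
    (Finset.prod_ne_zero_iff.2 fun i _ ↦ X_sub_C_ne_zero _)] at hroots
  simp only [roots_X_sub_C, Multiset.bind_singleton] at hroots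
  obtain ⟨σ, hσ⟩ : ∃ σ : Equiv.Perm n, μ = hH.eigenvalues ∘ σ :=
    exists_perm_of_map_univ_eq hroots
  have hV : (hH.eigenvectorUnitary : Matrix n n ℝ)ᵀ * hH.eigenvectorUnitary = 1 := by
    simpa [star_eq_conjTranspose] using Unitary.coe_star_mul_self hH.eigenvectorUnitary
  set V : Matrix n n ℝ := (hH.eigenvectorUnitary : Matrix n n ℝ).submatrix id σ with hVdef
  have hVV : Vᵀ * V = 1 := by
    rw [hVdef, transpose_submatrix, submatrix_mul _ _ _ _ _ Function.bijective_id |>.symm, hV,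
      submatrix_one_equiv]
  refine ⟨V, hVV, mul_eq_one_comm.1 hVV, ?_⟩
  ext i j
  have h := congrFun (hH.mulVec_eigenvectorBasis (σ j)) i
  rw [mul_diagonal, hσ]
  simpa [mul_apply, mulVec, dotProduct, hVdef, mul_comm] using h

/-- The rows of a real matrix with orthonormal columns have norm at most `1`. -/
lemma sum_sq_row_le_one {m n : Type*} [Fintype m] [Fintype n] [DecidableEq n]
    {P : Matrix m n ℝ} (hP : Pᵀ * P = 1) (i : m) : ∑ j, P i j ^ 2 ≤ 1 := by
  have hidem : (P * Pᵀ) * (P * Pᵀ) = P * Pᵀ := by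
    rw [Matrix.mul_assoc, ← Matrix.mul_assoc Pᵀ, hP, Matrix.one_mul]
  have hsymm (k) : (P * Pᵀ) k i = (P * Pᵀ) i k := by
    simp [mul_apply, mul_comm]
  have hdiag : ∑ j, P i j ^ 2 = (P * Pᵀ) i i := by
    simp [mul_apply, sq]
  have h : ∑ k, (P * Pᵀ) i k ^ 2 = (P * Pᵀ) i i := by
    conv_rhs => rw [← hidem, mul_apply]
    simp only [hsymm, sq]
  have hle := Finset.single_le_sum (f := fun k ↦ (P * Pᵀ) i k ^ 2)
    (fun k _ ↦ sq_nonneg _) (Finset.mem_univ i)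
  rw [hdiag]
  simp only [h] at hle
  nlinarith

/-- Tight interlacing: with `A` symmetric, `K` with orthonormal columns and
`B = Kᵀ * A * K`, if the interlacing of the (decreasingly ordered) eigenvalues of `B`
in those of `A` is tight, i.e. for some `u ≤ M` one has `μA v = μB v` for `v < u` and
`μB v = μA (N - M + v)` for `v ≥ u`, then `K * B = A * K`. -/
theorem tight_interlacing_commutes
    (N M : ℕ) (hM : 0 < M) (hMN : M ≤ N)
    (A : Matrix (Fin N) (Fin N) ℝ) (hA : A.IsSymm)
    (K : Matrix (Fin N) (Fin M) ℝ) (hK : Kᵀ * K = 1)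
    (μA : Fin N → ℝ) (hμA : ∀ i j : Fin N, i ≤ j → μA j ≤ μA i)
    (hAchar : A.charpoly = ∏ i, (X - C (μA i)))
    (μB : Fin M → ℝ) (hμB : ∀ i j : Fin M, i ≤ j → μB j ≤ μB i)
    (hBchar : (Kᵀ * A * K).charpoly = ∏ i, (X - C (μB i)))
    (u : ℕ) (hu : u ≤ M)
    (htight₁ : ∀ v : Fin M, v.val < u → μA (Fin.castLE hMN v) = μB v)
    (htight₂ : ∀ v : Fin M, u ≤ v.val →
      μB v = μA ⟨v.val + (N - M), by have := v.isLt; omega⟩) :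
    K * (Kᵀ * A * K) = A * K := by
  have hB : (Kᵀ * A * K).IsSymm := by
    simp [Matrix.IsSymm, transpose_mul, hA.eq, Matrix.mul_assoc]
  obtain ⟨V, hV, hV', hAV⟩ := exists_orthogonal_mul_eq_mul_diagonal hA hAchar
  obtain ⟨W, hW, hW', hBW⟩ := exists_orthogonal_mul_eq_mul_diagonal hB hBchar
  set P : Matrix (Fin N) (Fin M) ℝ := Vᵀ * K * W with hPdef
  have hVP : V * P = K * W := by
    rw [hPdef, ← Matrix.mul_assoc, ← Matrix.mul_assoc, hV', Matrix.one_mul]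
  have hP : Pᵀ * P = 1 := by
    calc Pᵀ * P = Pᵀ * (Vᵀ * V) * P := by rw [hV, Matrix.mul_one]
      _ = (V * P)ᵀ * (V * P) := by simp only [transpose_mul, Matrix.mul_assoc]
      _ = Wᵀ * (Kᵀ * K) * W := by rw [hVP]; simp only [transpose_mul, Matrix.mul_assoc]
      _ = 1 := by rw [hK, Matrix.mul_one, hW]
  have hPD : Pᵀ * (diagonal μA * P) = diagonal μB := by
    calc Pᵀ * (diagonal μA * P) = Pᵀ * (Vᵀ * V) * (diagonal μA * P) := by rw [hV, Matrix.mul_one]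
      _ = (V * P)ᵀ * (V * diagonal μA * P) := by simp only [transpose_mul, Matrix.mul_assoc]
      _ = (V * P)ᵀ * (A * (V * P)) := by rw [← hAV, Matrix.mul_assoc]
      _ = Wᵀ * (Kᵀ * A * K * W) := by rw [hVP]; simp only [transpose_mul, Matrix.mul_assoc]
      _ = diagonal μB := by rw [hBW, ← Matrix.mul_assoc, hW, Matrix.one_mul]
  have hcol (j) : ∑ i, P i j ^ 2 = 1 := by
    simpa [mul_apply, sq] using congrFun₂ hP j j
  have hb (j) : ∑ i, μA i * P i j ^ 2 = μB j := by
    have h := congrFun₂ hPD j j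
    rw [mul_apply, diagonal_apply_eq] at h
    rw [← h]
    refine Finset.sum_congr rfl fun i _ ↦ ?_
    rw [diagonal_mul, transpose_apply]
    ring
  have hsupp (i j) : P i j ^ 2 * (μA i - μB j) = 0 := by
    rcases lt_or_ge j.val u with hj | hj
    · exact substochastic_mul_sub_eq_zero hMN (fun _ _ h ↦ hμA _ _ h) (q := fun i j ↦ P i j ^ 2)
        (fun _ _ ↦ sq_nonneg _) (sum_sq_row_le_one hP) hcol hb j
        (fun k hk ↦ htight₁ k (lt_of_le_of_lt hk hj)) i
    · have h := substochastic_mul_sub_eq_zero hMN (a := fun i ↦ -μA i.rev)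
        (b := fun j ↦ -μB j.rev) (fun _ _ h ↦ neg_le_neg (hμA _ _ (Fin.rev_le_rev.2 h)))
        (q := fun i j ↦ P i.rev j.rev ^ 2) (fun _ _ ↦ sq_nonneg _)
        (fun i ↦ (Equiv.sum_comp Fin.revPerm fun j ↦ P i.rev j ^ 2).trans_le
          (sum_sq_row_le_one hP i.rev))
        (fun j ↦ (Equiv.sum_comp Fin.revPerm fun i ↦ P i j.rev ^ 2).trans (hcol j.rev))
        (fun j ↦ by
          rw [← hb, ← Finset.sum_neg_distrib,
            ← Equiv.sum_comp Fin.revPerm fun i ↦ -(μA i * P i j.rev ^ 2)]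
          simp)
        j.rev
        (fun k hk ↦ by
          have hk' : k.val ≤ M - (j.val + 1) := by simpa [Fin.le_def] using hk
          rw [htight₂ k.rev (by rw [Fin.val_rev]; omega)]
          congr 2
          ext
          simp only [Fin.val_rev, Fin.val_castLE]
          omega)
        i.rev
      simp only [Fin.rev_rev] at h
      linarith
  have hcomm : diagonal μA * P = P * diagonal μB := by
    ext i j
    rw [diagonal_mul, mul_diagonal]
    rcases mul_eq_zero.1 (hsupp i j) with h | h
    · simp [pow_eq_zero_iff two_ne_zero |>.1 h]
    · rw [sub_eq_zero.1 h, mul_comm]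
  have hKW : K * (Kᵀ * A * K) * W = A * K * W := by
    rw [Matrix.mul_assoc, hBW, ← Matrix.mul_assoc, ← hVP, Matrix.mul_assoc, ← hcomm,
      ← Matrix.mul_assoc, ← hAV, Matrix.mul_assoc, hVP, Matrix.mul_assoc]
  calc K * (Kᵀ * A * K) = K * (Kᵀ * A * K) * W * Wᵀ := by
        rw [Matrix.mul_assoc _ W, hW', Matrix.mul_one]
    _ = A * K := by rw [hKW, Matrix.mul_assoc _ W, hW', Matrix.mul_one]
end

section
/- Let N and M be positive integers, let A be an N×N real matrix, C an M×M real matrix, D₁ an N×N diagonal real matrix, D₂ an M×M diagonal real matrix, and K an N×M real matrix with Kᵀ * K = 1 (orthonormal columns). Suppose A * K = K * C and D₁ * K = K * D₂. Then for every λ : ℝ and every vector x : Fin M → ℝ with x ≠ 0 and (D₂ - C).mulVec x = λ • x, the vector K.mulVec x is nonzero and (D₁ - A).mulVec (K.mulVec x) = λ • (K.mulVec x); in particular every eigenvalue of D₂ - C is an eigenvalue of D₁ - A. -/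
open Matrix

/-- Laplacian eigenvector lifting: if `K` has orthonormal columns, `A * K = K * C` and
`D₁ * K = K * D₂` with `D₁`, `D₂` diagonal, then every eigenvector `x` of `D₂ - C`
with eigenvalue `λ` lifts to the eigenvector `K.mulVec x` of `D₁ - A` with the same
eigenvalue `λ`; in particular every eigenvalue of `D₂ - C` is an eigenvalue of `D₁ - A`. -/
theorem laplacian_eigenvector_lift_of_commuting_reduction
    (N M : ℕ) (hN : 0 < N) (hM : 0 < M)
    (A : Matrix (Fin N) (Fin N) ℝ) (C : Matrix (Fin M) (Fin M) ℝ)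
    (D₁ : Matrix (Fin N) (Fin N) ℝ) (hD₁ : D₁.IsDiag)
    (D₂ : Matrix (Fin M) (Fin M) ℝ) (hD₂ : D₂.IsDiag)
    (K : Matrix (Fin N) (Fin M) ℝ) (hK : Kᵀ * K = 1)
    (hAK : A * K = K * C) (hDK : D₁ * K = K * D₂) :
    ∀ (lam : ℝ) (x : Fin M → ℝ), x ≠ 0 → (D₂ - C).mulVec x = lam • x →
      K.mulVec x ≠ 0 ∧ (D₁ - A).mulVec (K.mulVec x) = lam • (K.mulVec x) := by
  intro lam x hx h
  refine ⟨fun h0 => hx ?_, ?_⟩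
  · rw [← one_mulVec x, ← hK, ← mulVec_mulVec, h0, mulVec_zero]
  · rw [mulVec_mulVec, Matrix.sub_mul, hDK, hAK, ← Matrix.mul_sub, ← mulVec_mulVec, h, mulVec_smul]
end

section
/- Let N be a positive integer, let A be a symmetric N×N real matrix, and let S₁, ..., S_r be pairwise disjoint finite sets of indices with |S_l| = m_l, such that within each S_l all rows of A coincide (for all i, j ∈ S_l and all k, A i k = A j k). Then 0 is an eigenvalue of A with multiplicity at least ∑_{l=1}^{r} (m_l - 1); precisely, the kernel of the linear map x ↦ A.mulVec x has dimension at least ∑_{l=1}^{r} (m_l - 1). -/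
open Matrix

/-- If every row of `A` coincides with a row indexed outside `B`, then the kernel of
`x ↦ A.mulVec x` has dimension at least `B.card`. -/
theorem Matrix.card_le_finrank_ker_mulVecLin {n K : Type*} [Fintype n] [DecidableEq n] [Field K]
    (A : Matrix n n K) (B : Finset n) (h : ∀ i, ∃ j ∉ B, A i = A j) :
    B.card ≤ Module.finrank K (LinearMap.ker A.mulVecLin) := by
  classical
  have hrank : A.rank ≤ Bᶜ.card := by
    have hrange : Set.range A.row ⊆ (Bᶜ.image A.row : Finset (n → K)) := by
      rintro _ ⟨i, rfl⟩
      obtain ⟨j, hj, hij⟩ := h i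
      exact Finset.mem_coe.2 (Finset.mem_image.2 ⟨j, Finset.mem_compl.2 hj, hij.symm⟩)
    rw [Matrix.rank_eq_finrank_span_row]
    exact (Submodule.finrank_mono (Submodule.span_mono hrange)).trans
      ((finrank_span_finset_le_card _).trans Finset.card_image_le)
  have hsum := LinearMap.finrank_range_add_finrank_ker A.mulVecLin
  rw [Module.finrank_fintype_fun_eq_card] at hsum
  have hcompl := B.card_add_card_compl
  change Module.finrank K (LinearMap.range A.mulVecLin) ≤ _ at hrank
  omega

/-- If a symmetric real matrix `A` has `r` pairwise disjoint families of coinciding rows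
(the `l`-th family indexed by a set `S l` of cardinality `m l`), then `0` is an
eigenvalue of `A` of multiplicity at least `∑ l, (m l - 1)`: the kernel of
`x ↦ A.mulVec x` has dimension at least `∑ l, (m l - 1)`. -/
theorem adjacency_kernel_of_hyperstars
    (N r : ℕ) (hN : 0 < N) (A : Matrix (Fin N) (Fin N) ℝ) (hA : A.IsSymm)
    (S : Fin r → Finset (Fin N)) (m : Fin r → ℕ)
    (hcard : ∀ l, (S l).card = m l)
    (hdisj : ∀ l l', l ≠ l' → Disjoint (S l) (S l'))
    (hrows : ∀ l, ∀ i ∈ S l, ∀ j ∈ S l, ∀ k, A i k = A j k) :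
    (∑ l, (m l - 1)) ≤ Module.finrank ℝ (LinearMap.ker (Matrix.mulVecLin A)) := by
  have hB : ∀ l, ∃ B ⊆ S l, B.card = m l - 1 ∧ (B.Nonempty → ∃ j ∈ S l, j ∉ B) := by
    intro l
    obtain hl | ⟨a, ha⟩ := (S l).eq_empty_or_nonempty
    · exact ⟨∅, Finset.empty_subset _, by simp [← hcard, hl], by simp⟩
    · exact ⟨(S l).erase a, Finset.erase_subset _ _, by rw [Finset.card_erase_of_mem ha, hcard],
        fun _ => ⟨a, ha, Finset.notMem_erase _ _⟩⟩
  choose B hBS hBcard hBrep using hB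
  have hcardB : (Finset.univ.biUnion B).card = ∑ l, (m l - 1) := by
    rw [Finset.card_biUnion fun l _ l' _ hl => (hdisj l l' hl).mono (hBS l) (hBS l')]
    exact Finset.sum_congr rfl fun l _ => hBcard l
  rw [← hcardB]
  refine A.card_le_finrank_ker_mulVecLin _ fun i => ?_
  by_cases hi : i ∈ Finset.univ.biUnion B
  · obtain ⟨l, -, hil⟩ := Finset.mem_biUnion.1 hi
    obtain ⟨j, hjS, hjB⟩ := hBrep l ⟨i, hil⟩
    refine ⟨j, fun hj => ?_, funext (hrows l i (hBS l hil) j hjS)⟩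
    obtain ⟨l', -, hjl'⟩ := Finset.mem_biUnion.1 hj
    obtain rfl | hne := eq_or_ne l l'
    · exact hjB hjl'
    · exact Finset.disjoint_left.1 (hdisj l l' hne) hjS (hBS l' hjl')
  · exact ⟨i, hi, rfl⟩
end
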